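/- Let A₀…A_m be the sail diagram of a convex n-gon with integer vertices whose angle-curvature sequence is S = (α₁,κ₁,…,α_{n−1},κ_{n−1},αₙ,κₙ). Then the number of sign changes of the sequence (K(lls(S₁ʲ)))_{j=1}^{n} equals twice the winding number of A₀…A_m about the origin, minus 1. -/

import Mathlib

open scoped BigOperators

/-- Integer points of the plane. -/
abbrev Pt := ℤ × ℤ

/-- Determinant of two integer vectors. -/
def vdet (u v : Pt) : ℤ := u.1 * v.2 - u.2 * v.1

/-- Integer length of the segment `PQ`. -/
def il (P Q : Pt) : ℤ := Int.gcd (Q.1 - P.1) (Q.2 - P.2)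

/-- Integer distance from the point `P` to the line through `S` and `T`. -/
def idist (P S T : Pt) : ℤ := |vdet (T - S) (P - S)| / il S T

/-- The primitive integer vector in the direction from `P` to `Q`. -/
def primVec (P Q : Pt) : Pt := ((Q.1 - P.1) / il P Q, (Q.2 - P.2) / il P Q)

/-- `Q` lies on the ray emanating from `V` through `X`. -/
def OnRay (V X Q : Pt) : Prop := ∃ s t : ℤ, 0 < s ∧ 0 < t ∧ s • (Q - V) = t • (X - V)

/-- `P` lies in the convex angle with vertex `V` and edge rays towards `X` and `Y`. -/
def InAngle (X V Y P : Pt) : Prop :=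
  ∃ q s t : ℤ, 0 < q ∧ 0 ≤ s ∧ 0 ≤ t ∧ q • (P - V) = s • (X - V) + t • (Y - V)

/-- An affine lattice-preserving transformation of `ℤ²` (an element of Aff(2,ℤ)). -/
structure IntAff where
  a : ℤ
  b : ℤ
  c : ℤ
  d : ℤ
  u : ℤ
  v : ℤ
  unimod : a * d - b * c = 1 ∨ a * d - b * c = -1

/-- Action of an element of Aff(2,ℤ) on an integer point. -/
def IntAff.apply (T : IntAff) (P : Pt) : Pt :=
  (T.a * P.1 + T.b * P.2 + T.u, T.c * P.1 + T.d * P.2 + T.v)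

/-- Integer congruence of the angles ∠XVY and ∠X'V'Y' (vertices `V`, `V'`). -/
def AngleCong (X V Y X' V' Y' : Pt) : Prop :=
  ∃ T : IntAff, T.apply V = V' ∧ OnRay V' X' (T.apply X) ∧ OnRay V' Y' (T.apply Y)

/-- Auxiliary function: continuant of the reversed list. -/
def contRev : List ℤ → ℤ
  | [] => 1
  | [x] => x
  | x :: y :: l => x * contRev (y :: l) + contRev l

/-- The continuant `K`: `K(ε)=1`, `K(x₁)=x₁`,
`K(x₁,…,xₙ)=xₙK(x₁,…,x_{n−1})+K(x₁,…,x_{n−2})`. -/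
def cont (l : List ℤ) : ℤ := contRev l.reverse

/-- A list is a valid LLS sequence of a rational integer angle:
odd length and positive entries. -/
def ValidLLS (l : List ℤ) : Prop := l.length % 2 = 1 ∧ ∀ x ∈ l, 0 < x

/-- The second edge point of the standard angle ∠(a₀,…,a₂ₘ):
the point `(K(a₁,…,a₂ₘ), K(a₀,…,a₂ₘ))`. -/
def stdPt (l : List ℤ) : Pt := (cont l.tail, cont l)

/-- The angle ∠XVY (vertex `V`) is a rational angle with LLS sequence `l`;
equivalently it is integer congruent to the standard angle
∠((1,0),(0,0),(K(a₁,…,a₂ₘ),K(a₀,…,a₂ₘ))) of the list. -/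
def IsLLSOfAngle (X V Y : Pt) (l : List ℤ) : Prop :=
  ValidLLS l ∧ AngleCong ((1, 0) : Pt) ((0, 0) : Pt) (stdPt l) X V Y

open Classical in
/-- Direction comparison sign `sgn⟨u,w⟩`: `1` if `w` has the same direction as `u`,
`0` if `w = 0`, and `-1` otherwise. -/
noncomputable def sgnDir (u w : Pt) : ℤ :=
  if w = ((0 : ℤ), (0 : ℤ)) then 0
  else if ∃ s t : ℤ, 0 < s ∧ 0 < t ∧ s • w = t • u then 1 else -1

/-- `P` is the integer point of the angle ∠XVY at integer distance 1 from the
line `VY` which is closest to the line `XV`. -/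
def IsNearPt (X V Y P : Pt) : Prop :=
  InAngle X V Y P ∧ idist P V Y = 1 ∧
  ∀ Q : Pt, InAngle X V Y Q → idist Q V Y = 1 → idist P X V ≤ idist Q X V

/-- `k` is the chord curvature of the locally convex broken line `ABCD`. -/
def IsChordCurv (A B C D : Pt) (k : ℤ) : Prop :=
  ∃ B' C' : Pt, IsNearPt A B C B' ∧ IsNearPt D C B C' ∧
    k = il B C - sgnDir (C - B) (C' - B') * il B' C' - 2

/-- `A` lists the vertices of a convex polygon (in convex position, ordered so that
all interior angles are positively oriented). -/
def ConvexPolygon (n : ℕ) (A : ZMod n → Pt) : Prop :=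
  ∀ i j : ZMod n, j ≠ i → j ≠ i + 1 → vdet (A (i + 1) - A i) (A j - A i) < 0

/-- A closed broken line (polygon) all of whose angles have the same orientation. -/
def LocallyConvexPolygon (n : ℕ) (A : ZMod n → Pt) : Prop :=
  (∀ i : ZMod n, 0 < vdet (A (i - 1) - A i) (A (i + 1) - A i)) ∨
  (∀ i : ZMod n, vdet (A (i - 1) - A i) (A (i + 1) - A i) < 0)

/-- A locally convex closed polygon with positively oriented angles. -/
def PosLocConvexPolygon (n : ℕ) (A : ZMod n → Pt) : Prop :=
  ∀ i : ZMod n, 0 < vdet (A (i - 1) - A i) (A (i + 1) - A i)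

/-- A locally convex broken line `A 0 … A (n+1)` (angles at vertices `1,…,n`). -/
def LocallyConvexBL (n : ℕ) (A : ℕ → Pt) : Prop :=
  (∀ i, 1 ≤ i → i ≤ n → 0 < vdet (A (i - 1) - A i) (A (i + 1) - A i)) ∨
  (∀ i, 1 ≤ i → i ≤ n → vdet (A (i - 1) - A i) (A (i + 1) - A i) < 0)

/-- A locally convex broken line with positively oriented angles. -/
def PosLocConvexBL (n : ℕ) (A : ℕ → Pt) : Prop :=
  ∀ i, 1 ≤ i → i ≤ n → 0 < vdet (A (i - 1) - A i) (A (i + 1) - A i)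

/-- The polygon `A` (with `n` vertices) has angle-curvature sequence
`(L 0, κ 0, …, L (n-1), κ (n-1))` (0-indexed). -/
def HasACS (n : ℕ) (A : ZMod n → Pt) (L : ℕ → List ℤ) (κ : ℕ → ℤ) : Prop :=
  ∀ i : ℕ, i < n →
    IsLLSOfAngle (A ((i : ZMod n) - 1)) (A (i : ZMod n)) (A ((i : ZMod n) + 1)) (L i) ∧
    IsChordCurv (A ((i : ZMod n) - 1)) (A (i : ZMod n)) (A ((i : ZMod n) + 1))
      (A ((i : ZMod n) + 2)) (κ i)

/-- `llsCat L κ j m = lls(S_j^{j+m})`, the concatenation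
`lls(α_j) ∘ (κ_j) ∘ ⋯ ∘ (κ_{j+m-1}) ∘ lls(α_{j+m})` (0-indexed angles). -/
def llsCat (L : ℕ → List ℤ) (κ : ℕ → ℤ) (j : ℕ) : ℕ → List ℤ
  | 0 => L j
  | m + 1 => llsCat L κ j m ++ (κ (j + m) :: L (j + m + 1))

/-- Number of consecutive opposite-sign pairs. -/
def altCount : List ℤ → ℕ
  | x :: y :: l => (if x * y < 0 then 1 else 0) + altCount (y :: l)
  | _ => 0

/-- Number of sign changes of an integer sequence: after removing all zero
elements, the number of pairs of consecutive elements with opposite signs. -/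
def signChanges (l : List ℤ) : ℕ := altCount (l.filter (fun x => x != 0))

/-- Coercion of an integer point to the real plane. -/
noncomputable def toR (P : Pt) : ℝ × ℝ := ((P.1 : ℝ), (P.2 : ℝ))

/-- The integer points of the angle ∠XVY distinct from the vertex. -/
def conePts (X V Y : Pt) : Set Pt := {P | InAngle X V Y P ∧ P ≠ V}

/-- `P` is a vertex of the sail of the angle ∠XVY: an integer point of the
angle (other than the vertex) which is a vertex of the convex hull of all
such points. -/
def SailVertex (X V Y P : Pt) : Prop :=
  P ∈ conePts X V Y ∧ toR P ∉ convexHull ℝ (toR '' (conePts X V Y \ {P}))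

/-- `B 0, …, B m` is the broken line formed by the vertices of the sail of the
angle ∠XVY, ordered from the edge `VX` to the edge `VY`. -/
def IsSailBL (X V Y : Pt) (m : ℕ) (B : ℕ → Pt) : Prop :=
  (∀ i ≤ m, SailVertex X V Y (B i)) ∧
  (∀ P, SailVertex X V Y P → ∃ i ≤ m, B i = P) ∧
  (∀ i ≤ m, ∀ j ≤ m, B i = B j → i = j) ∧
  OnRay V X (B 0) ∧ OnRay V Y (B m) ∧
  (∀ i < m, vdet (B (i + 1) - B i) (V - B i) ≠ 0 ∧
    ∀ P, SailVertex X V Y P →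
      vdet (B (i + 1) - B i) (V - B i) * vdet (B (i + 1) - B i) (P - B i) ≤ 0)

/-- Sign alternation used in sail diagrams (`1` on the first angle). -/
def sgnAlt (i : ℕ) : ℤ := if i % 2 = 0 then 1 else -1

/-- `D` is the sail diagram of the polygon `A` with the decomposition data
`m` (numbers of sail edges), `c` (offsets) and `B` (sails of the angles):
the concatenation of the sails of the consecutive angles translated to the
origin, composed with the central symmetry for alternate angles. -/
def IsSailDiagramAux (n : ℕ) (A : ZMod n → Pt) (m c : ℕ → ℕ) (B : ℕ → ℕ → Pt)
    (D : ℕ → Pt) : Prop :=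
  c 0 = 0 ∧ (∀ i, c (i + 1) = c i + m i) ∧
  ∀ i < n,
    IsSailBL (A ((i : ZMod n) - 1)) (A (i : ZMod n)) (A ((i : ZMod n) + 1)) (m i) (B i) ∧
    ∀ j ≤ m i, D (c i + j) = sgnAlt i • (B i j - A (i : ZMod n))

/-- `D 0 … D M` is the sail diagram of the polygon `A`. -/
def IsSailDiagram (n : ℕ) (A : ZMod n → Pt) (M : ℕ) (D : ℕ → Pt) : Prop :=
  ∃ m c B, IsSailDiagramAux n A m c B D ∧ M = c n

/-- `D 0 … D M` is the sail diagram of the broken line `A 0 … A (n+1)`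
(whose angles are at the vertices `1,…,n`). -/
def IsSailDiagramBL (n : ℕ) (A : ℕ → Pt) (M : ℕ) (D : ℕ → Pt) : Prop :=
  ∃ (m c : ℕ → ℕ) (B : ℕ → ℕ → Pt),
    c 1 = 0 ∧ (∀ i, c (i + 1) = c i + m i) ∧ M = c (n + 1) ∧
    ∀ i, 1 ≤ i → i ≤ n →
      IsSailBL (A (i - 1)) (A i) (A (i + 1)) (m i) (B i) ∧
      ∀ j ≤ m i, D (c i + j) = sgnAlt (i + 1) • (B i j - A i)

/-- Euclidean angular measure of the angle between the vectors `u` and `v`. -/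
noncomputable def angMeasure (u v : Pt) : ℝ :=
  Real.arccos (((u.1 * v.1 + u.2 * v.2 : ℤ) : ℝ) /
    (Real.sqrt ((u.1 : ℝ) ^ 2 + (u.2 : ℝ) ^ 2) * Real.sqrt ((v.1 : ℝ) ^ 2 + (v.2 : ℝ) ^ 2)))

/-- Winding number of the broken line `D 0 … D M` about the origin. -/
noncomputable def winding (M : ℕ) (D : ℕ → Pt) : ℝ :=
  (∑ i ∈ Finset.range M, angMeasure (D i) (D (i + 1))) / (2 * Real.pi)

/-- The segment `(b st, b (st+1), …, b (st+len-1))` of a sequence as a list. -/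
def bseg (b : ℕ → ℤ) (st len : ℕ) : List ℤ := (List.range len).map fun t => b (st + t)

/-- The edge vertex `Bᵢ` of a normalized sail diagram, via continuants:
`(K(b₁,…,b_{2s}), K(b₀,…,b_{2s}))` where `s = s(i)`. -/
def BiPt (b : ℕ → ℤ) (s : ℕ) : Pt := (cont (bseg b 1 (2 * s)), cont (bseg b 0 (2 * s + 1)))

/-- The integer point `Bᵢ⁺` following `Bᵢ`:
`(K(b₁,…,b_{2s},b_{2s+1},1), K(b₀,…,b_{2s},b_{2s+1},1))`. -/
def BpPt (b : ℕ → ℤ) (s : ℕ) : Pt :=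
  (cont (bseg b 1 (2 * s) ++ [b (2 * s + 1), 1]),
   cont (bseg b 0 (2 * s + 1) ++ [b (2 * s + 1), 1]))

/-- The integer point `Bᵢ⁻` preceding `Bᵢ`:
`(K(b₁,…,b_{2s}−1), K(b₀,…,b_{2s}−1))`. -/
def BmPt (b : ℕ → ℤ) (s : ℕ) : Pt :=
  (cont (bseg b 1 (2 * s - 1) ++ [b (2 * s) - 1]),
   cont (bseg b 0 (2 * s) ++ [b (2 * s) - 1]))

/-- The point `B̂ᵢ = (K(b₁,…,b_{2s},0,1), K(b₀,…,b_{2s},0,1))`. -/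
def hatBPt (b : ℕ → ℤ) (s : ℕ) : Pt :=
  (cont (bseg b 1 (2 * s) ++ [0, 1]), cont (bseg b 0 (2 * s + 1) ++ [0, 1]))

noncomputable def toC (P : Pt) : ℂ := ⟨(P.1 : ℝ), (P.2 : ℝ)⟩

theorem toC_add (P Q : Pt) : toC (P + Q) = toC P + toC Q := by
  apply Complex.ext <;> simp [toC]

theorem toC_sub (P Q : Pt) : toC (P - Q) = toC P - toC Q := by
  apply Complex.ext <;> simp [toC]

theorem toC_smul (k : ℤ) (P : Pt) : toC (k • P) = (k : ℝ) • toC P := by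
  apply Complex.ext <;> simp [toC]

theorem toC_ne {P : Pt} (h : P ≠ 0) : toC P ≠ 0 := by
  intro h'
  apply h
  have h1 := congrArg Complex.re h'
  have h2 := congrArg Complex.im h'
  simp [toC] at h1 h2
  ext <;> simp [h1, h2]

theorem angMeasure_eq (u v : Pt) :
    angMeasure u v = InnerProductGeometry.angle (toC u) (toC v) := by
  unfold angMeasure InnerProductGeometry.angle
  have hn : ∀ w : Pt, ‖toC w‖ = Real.sqrt ((w.1 : ℝ) ^ 2 + (w.2 : ℝ) ^ 2) := by
    intro w
    rw [Complex.norm_def, Complex.normSq_apply]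
    simp [toC, pow_two]
  rw [hn, hn]
  congr 2
  simp [toC, Complex.inner]
  ring

theorem ang_smul {u v : Pt} {s t : ℤ} (hs : 0 < s) (ht : 0 < t) :
    angMeasure (s • u) (t • v) = angMeasure u v := by
  have hs' : (0 : ℝ) < s := by exact_mod_cast hs
  have ht' : (0 : ℝ) < t := by exact_mod_cast ht
  rw [angMeasure_eq, angMeasure_eq, toC_smul, toC_smul,
    InnerProductGeometry.angle_smul_left_of_pos _ _ hs',
    InnerProductGeometry.angle_smul_right_of_pos _ _ ht']

theorem ang_sgn (i : ℕ) (u v : Pt) :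
    angMeasure (sgnAlt i • u) (sgnAlt i • v) = angMeasure u v := by
  unfold sgnAlt
  split_ifs
  · simp
  · rw [angMeasure_eq, angMeasure_eq, toC_smul, toC_smul]
    simp [InnerProductGeometry.angle_neg_neg]

theorem ang_comm (u v : Pt) : angMeasure u v = angMeasure v u := by
  rw [angMeasure_eq, angMeasure_eq, InnerProductGeometry.angle_comm]

theorem ang_self {u : Pt} (h : u ≠ 0) : angMeasure u u = 0 := by
  rw [angMeasure_eq, InnerProductGeometry.angle_self (toC_ne h)]

theorem plucker (u v w : Pt) :
    vdet u w • v = vdet v w • u + vdet u v • w := by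
  ext <;> simp [vdet] <;> ring

theorem ang_add {u v w : Pt} (h1 : 0 < vdet u w) (h2 : 0 ≤ vdet u v) (h3 : 0 ≤ vdet v w)
    (hv : v ≠ 0) : angMeasure u w = angMeasure u v + angMeasure v w := by
  rw [angMeasure_eq, angMeasure_eq, angMeasure_eq]
  apply InnerProductGeometry.angle_eq_angle_add_add_angle_add_of_mem_span (toC_ne hv)
  have h1' : (0 : ℝ) < vdet u w := by exact_mod_cast h1
  have h2' : (0 : ℝ) ≤ vdet u v := by exact_mod_cast h2
  have h3' : (0 : ℝ) ≤ vdet v w := by exact_mod_cast h3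
  have hp := congrArg toC (plucker u v w)
  rw [toC_add, toC_smul, toC_smul, toC_smul] at hp
  rw [Submodule.mem_span_pair]
  refine ⟨Real.toNNReal (vdet v w / vdet u w), Real.toNNReal (vdet u v / vdet u w), ?_⟩
  simp only [NNReal.smul_def]
  rw [Real.coe_toNNReal _ (by positivity), Real.coe_toNNReal _ (by positivity)]
  have : toC v = ((vdet u w : ℝ)⁻¹) • ((vdet u w : ℝ) • toC v) := by
    rw [smul_smul, inv_mul_cancel₀ h1'.ne', one_smul]
  rw [this, hp, smul_add, smul_smul, smul_smul, div_eq_inv_mul, div_eq_inv_mul]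

theorem ang_tri {P Q R : Pt} (h : P ≠ Q) :
    angMeasure (R - P) (Q - P) + angMeasure (P - Q) (R - Q) + angMeasure (Q - R) (P - R)
      = Real.pi := by
  have hy : toC (Q - P) ≠ 0 := toC_ne (sub_ne_zero.2 h.symm)
  have := InnerProductGeometry.angle_add_angle_sub_add_angle_sub_eq_pi (toC (R - P)) hy
  rw [← toC_sub, ← toC_sub] at this
  rw [angMeasure_eq, angMeasure_eq, angMeasure_eq, ← this]
  have e1 : R - P - (Q - P) = -(Q - R) := by abel
  have e2 : Q - P - (R - P) = -(R - Q) := by abel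
  have e3 : R - P = - (P - R) := by abel
  have e4 : Q - P = - (P - Q) := by abel
  have hneg : ∀ P, toC (-P) = - toC P := by
    intro P; apply Complex.ext <;> simp [toC]
  rw [e1, e2, e3, e4]
  simp only [hneg, InnerProductGeometry.angle_neg_neg]
  rw [InnerProductGeometry.angle_comm (toC (P - R)) (toC (Q - R))]
  ring

theorem vdet_ne_left {u v : Pt} (h : vdet u v ≠ 0) : u ≠ 0 := by
  rintro rfl; simp [vdet] at h

theorem vdet_ne_right {u v : Pt} (h : vdet u v ≠ 0) : v ≠ 0 := by
  rintro rfl; simp [vdet] at h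

/-- angle sum of a convex polygon given as a natural-indexed sequence -/
theorem angle_sum (n : ℕ) (hn : 3 ≤ n) (a : ℕ → Pt)
    (h0 : ∀ i j, i + 1 < n → j < n → j ≠ i → j ≠ i + 1 →
      vdet (a (i + 1) - a i) (a j - a i) < 0) :
    ∀ k, k + 2 ≤ n → angMeasure (a (k + 1) - a 0) (a 1 - a 0) +
      ∑ i ∈ Finset.range k, angMeasure (a i - a (i + 1)) (a (i + 2) - a (i + 1)) +
      angMeasure (a k - a (k + 1)) (a 0 - a (k + 1)) = k * Real.pi := by
  intro k
  induction k with
  | zero =>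
    intro hk
    have h2 : a 1 - a 0 ≠ 0 := vdet_ne_left (h0 0 2 (by omega) (by omega) (by omega) (by omega)).ne
    have h3 : a 0 - a 1 ≠ 0 := by
      intro h; apply h2; rw [← neg_sub, h, neg_zero]
    simp [ang_self h2, ang_self h3]
  | succ k ih =>
    intro hk
    have ih := ih (by omega)
    rw [Finset.sum_range_succ]
    have d1 := h0 0 (k + 2) (by omega) (by omega) (by omega) (by omega)
    have d2 := h0 (k + 1) 0 (by omega) (by omega) (by omega) (by omega)
    have d3 := h0 k (k + 2) (by omega) (by omega) (by omega) (by omega)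
    have d4 : vdet (a (k + 1) - a k) (a 0 - a k) ≤ 0 := by
      rcases Nat.eq_zero_or_pos k with rfl | hk0
      · simp [vdet]
      · exact (h0 k 0 (by omega) (by omega) (by omega) (by omega)).le
    have d5 : vdet (a 1 - a 0) (a (k + 1) - a 0) ≤ 0 := by
      rcases Nat.eq_zero_or_pos k with rfl | hk0
      · simp [vdet, mul_comm]
      · exact (h0 0 (k + 1) (by omega) (by omega) (by omega) (by omega)).le
    have d2' : 0 < vdet (a (k + 2) - a 0) (a (k + 1) - a 0) := by
      simp [vdet] at *; linarith
    have d2'' : 0 < vdet (a 0 - a (k + 1)) (a (k + 2) - a (k + 1)) := by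
      simp [vdet] at *; linarith
    have t := ang_tri (P := a 0) (Q := a (k + 1)) (R := a (k + 2))
      (by intro h; rw [h] at d2''; simp [vdet] at d2'')
    have e1 : angMeasure (a (k + 2) - a 0) (a 1 - a 0) =
        angMeasure (a (k + 2) - a 0) (a (k + 1) - a 0) +
        angMeasure (a (k + 1) - a 0) (a 1 - a 0) := by
      apply ang_add _ d2'.le _ (vdet_ne_right d2'.ne')
      · simp [vdet] at *; linarith
      · simp [vdet] at *; linarith
    have e2 : angMeasure (a k - a (k + 1)) (a (k + 2) - a (k + 1)) =
        angMeasure (a k - a (k + 1)) (a 0 - a (k + 1)) +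
        angMeasure (a 0 - a (k + 1)) (a (k + 2) - a (k + 1)) := by
      apply ang_add _ _ d2''.le (vdet_ne_left d2''.ne')
      · simp [vdet] at *; linarith
      · simp [vdet] at *; linarith
    push_cast
    rw [show k + 1 + 1 = k + 2 from rfl, e1, e2]
    linarith
theorem altCount_snoc (l : List ℤ) (a b : ℤ) :
    altCount (l ++ [a] ++ [b]) = altCount (l ++ [a]) + (if a * b < 0 then 1 else 0) := by
  induction l with
  | nil => simp [altCount]
  | cons u l ih =>
    cases l with
    | nil => simp [altCount]
    | cons v l =>
      simp only [List.cons_append, altCount] at ih ⊢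
      rw [ih]; ring

def SgnSt (y : ℕ → ℤ) (k c : ℕ) (s : ℤ) : Prop :=
  ∃ l z, ((List.range k).map y).filter (fun x => x != 0) = l ++ [z] ∧
    altCount (l ++ [z]) = c ∧ 0 < s * z

theorem SgnSt.zero {y : ℕ → ℤ} {k c : ℕ} {s : ℤ} (h : SgnSt y k c s) (h0 : y k = 0) :
    SgnSt y (k + 1) c s := by
  obtain ⟨l, z, h1, h2, h3⟩ := h
  refine ⟨l, z, ?_, h2, h3⟩
  rw [List.range_succ, List.map_append, List.filter_append, h1]
  simp [h0]

theorem SgnSt.same {y : ℕ → ℤ} {k c : ℕ} {s : ℤ} (h : SgnSt y k c s) (h0 : 0 < s * y k) :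
    SgnSt y (k + 1) c s := by
  obtain ⟨l, z, h1, h2, h3⟩ := h
  have hk : y k ≠ 0 := by rintro h; simp [h] at h0
  refine ⟨l ++ [z], y k, ?_, ?_, h0⟩
  · rw [List.range_succ, List.map_append, List.filter_append, h1]
    simp [hk]
  · rw [altCount_snoc, h2, if_neg]
    · simp
    · nlinarith [mul_pos h3 h0, sq_nonneg s]

theorem SgnSt.opp {y : ℕ → ℤ} {k c : ℕ} {s : ℤ} (h : SgnSt y k c s) (h0 : 0 < (-s) * y k) :
    SgnSt y (k + 1) (c + 1) (-s) := by
  obtain ⟨l, z, h1, h2, h3⟩ := h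
  have hk : y k ≠ 0 := by rintro h; simp [h] at h0
  refine ⟨l ++ [z], y k, ?_, ?_, h0⟩
  · rw [List.range_succ, List.map_append, List.filter_append, h1]
    simp [hk]
  · rw [altCount_snoc, h2, if_pos]
    nlinarith [mul_pos h3 h0, sq_nonneg s]

theorem sgnAlt_succ (k : ℕ) : sgnAlt (k + 1) = - sgnAlt k := by
  unfold sgnAlt
  split_ifs <;> omega

theorem sgnAlt_sq (k : ℕ) : sgnAlt k * sgnAlt k = 1 := by
  unfold sgnAlt
  split_ifs <;> rfl

theorem signChanges_main (n : ℕ) (hn : 3 ≤ n) (x y : ℕ → ℤ)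
    (hy : ∀ j < n, ∃ c : ℤ, 0 < c ∧ c * y j = sgnAlt j * x j)
    (hx0 : 0 < x 0) (hxl : x (n - 2) < 0) (hxn : x (n - 1) = 0)
    (hx : ∀ j, j + 1 < n - 1 → x j ≤ 0 → x (j + 1) < 0) :
    signChanges ((List.range n).map y) = n - 3 := by
  have ypos : ∀ j < n, 0 < x j → 0 < sgnAlt j * y j := by
    intro j hj hxj
    obtain ⟨c, hc, h⟩ := hy j hj
    have : c * (sgnAlt j * y j) = x j := by
      linear_combination sgnAlt j * h + x j * sgnAlt_sq j
    rw [← this] at hxj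
    exact pos_of_mul_pos_right hxj hc.le
  have yneg : ∀ j < n, x j < 0 → 0 < (-sgnAlt j) * y j := by
    intro j hj hxj
    obtain ⟨c, hc, h⟩ := hy j hj
    have : c * (-sgnAlt j * y j) = - x j := by
      linear_combination -sgnAlt j * h - x j * sgnAlt_sq j
    have h2 : 0 < c * (-sgnAlt j * y j) := by rw [this]; omega
    exact pos_of_mul_pos_right h2 hc.le
  have yzero : ∀ j < n, x j = 0 → y j = 0 := by
    intro j hj hxj
    obtain ⟨c, hc, h⟩ := hy j hj
    rw [hxj, mul_zero] at h
    rcases mul_eq_zero.1 h with h | h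
    · omega
    · exact h
  have hex : ∃ p, x p ≤ 0 := ⟨n - 2, hxl.le⟩
  classical
  obtain ⟨p, hp, hpmin⟩ : ∃ p, x p ≤ 0 ∧ ∀ m < p, 0 < x m :=
    ⟨Nat.find hex, Nat.find_spec hex, fun m hm => not_le.1 (Nat.find_min hex hm)⟩
  have hpn : p ≤ n - 2 := by
    by_contra h
    have := hpmin (n - 2) (by omega)
    omega
  have hp0 : 0 < p := by
    rcases Nat.eq_zero_or_pos p with rfl | h
    · omega
    · exact h
  have ph1 : ∀ k, k < p → SgnSt y (k + 1) k (sgnAlt k) := by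
    intro k
    induction k with
    | zero =>
      intro _
      have h0 := ypos 0 (by omega) hx0
      have : y 0 ≠ 0 := by intro h; simp [h] at h0
      exact ⟨[], y 0, by simp [this], by simp [altCount], h0⟩
    | succ k ih =>
      intro hk
      have := ih (by omega)
      have h1 := ypos (k + 1) (by omega) (hpmin _ hk)
      rw [sgnAlt_succ] at h1 ⊢
      exact this.opp h1
  have ph2 : SgnSt y (p + 1) (p - 1) (sgnAlt (p + 1)) := by
    obtain ⟨q, rfl⟩ : ∃ q, p = q + 1 := ⟨p - 1, by omega⟩
    have := ph1 q (by omega)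
    rw [sgnAlt_succ, sgnAlt_succ, neg_neg]
    rcases hp.lt_or_eq with h | h
    · have h1 := yneg (q + 1) (by omega) h
      rw [sgnAlt_succ, neg_neg] at h1
      exact this.same h1
    · exact this.zero (yzero _ (by omega) h)
  have ph3 : ∀ k, p + 1 + k ≤ n - 1 → SgnSt y (p + 1 + k) (p - 1 + k) (sgnAlt (p + 1 + k)) ∧
      (p + 1 + k < n - 1 → x (p + 1 + k) < 0) := by
    intro k
    induction k with
    | zero =>
      intro _
      exact ⟨ph2, fun h => hx p h hp⟩
    | succ k ih =>
      intro hk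
      obtain ⟨h1, h2⟩ := ih (by omega)
      have h2 := h2 (by omega)
      refine ⟨?_, fun h => hx (p + 1 + k) h h2.le⟩
      have h3 := yneg _ (by omega) h2
      have h4 := h1.opp h3
      rw [← add_assoc, ← add_assoc, sgnAlt_succ]
      exact h4
  have h4 := (ph3 (n - 1 - (p + 1)) (by omega)).1
  have h5 : p + 1 + (n - 1 - (p + 1)) = n - 1 := by omega
  rw [h5] at h4
  have h6 := h4.zero (yzero _ (by omega) hxn)
  rw [show n - 1 + 1 = n by omega] at h6
  obtain ⟨l, z, h7, h8, _⟩ := h6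
  unfold signChanges
  rw [h7, h8]
  omega
theorem hull_seg (S : Set (ℝ × ℝ)) (V b : Pt) (N : ℤ) (hN : 1 < N)
    (h1 : toR (V + b) ∈ S) (h2 : toR (V + N • b) ∈ S) (t : ℝ) (ht1 : 1 ≤ t) (ht2 : t ≤ N) :
    toR V + t • toR b ∈ convexHull ℝ S := by
  have hN' : (0 : ℝ) < (N : ℝ) - 1 := by
    have : (1 : ℝ) < N := by exact_mod_cast hN
    linarith
  have c := (convex_convexHull ℝ S) (subset_convexHull ℝ S h1) (subset_convexHull ℝ S h2)
    (a := (N - t) / (N - 1)) (b := (t - 1) / (N - 1))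
    (div_nonneg (by linarith) hN'.le) (div_nonneg (by linarith) hN'.le)
    (by field_simp; ring)
  convert c using 1
  ext
  · simp [toR]; field_simp; ring
  · simp [toR]; field_simp; ring

theorem cone_smul {X V Y b : Pt} (h : V + b ∈ conePts X V Y) (N : ℤ) (hN : 0 < N) :
    V + N • b ∈ conePts X V Y := by
  obtain ⟨⟨q, s, t, hq, hs, ht, e⟩, hne⟩ := h
  refine ⟨⟨q, N * s, N * t, hq, by positivity, by positivity, ?_⟩, ?_⟩
  · rw [add_sub_cancel_left] at e ⊢
    rw [smul_comm, e, smul_add, mul_smul, mul_smul]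
  · intro h
    apply hne
    have : N • b = 0 := by simpa using h
    rcases smul_eq_zero.1 this with h | h
    · omega
    · simp [h]

theorem sail_between {X V Y b b' r : Pt} (hP : SailVertex X V Y (V + r))
    (hb : V + b ∈ conePts X V Y) (hb' : V + b' ∈ conePts X V Y)
    (h1 : 0 < vdet b r) (h2 : 0 < vdet r b') (hd : 0 < vdet b b')
    (h3 : vdet (b' - b) (r - b) ≤ 0) : False := by
  apply hP.2
  set S := toR '' (conePts X V Y \ {V + r}) with hS
  set x := vdet r b' with hx
  set y := vdet b r with hy
  set d := vdet b b' with hdd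
  have hxy : d ≤ x + y := by
    simp only [hx, hy, hdd]
    simp [vdet] at h3 ⊢; linarith
  have hN : 1 < x + y := by omega
  have memS : ∀ (c : Pt) (k : ℤ), V + c ∈ conePts X V Y → 0 < k → vdet c r ≠ 0 → toR (V + k • c) ∈ S := by
    intro c k hc hk hv
    refine ⟨_, ⟨cone_smul hc k hk, ?_⟩, rfl⟩
    intro he
    have he : V + k • c = V + r := he
    have he : k • c = r := by simpa using he
    apply hv
    rw [← he]
    simp [vdet]; ring
  have hb'r : vdet b' r ≠ 0 := by
    have : vdet b' r = - x := by simp only [hx]; simp [vdet]; ring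
    omega
  have hdR : (0 : ℝ) < d := by exact_mod_cast hd
  have hxR : (0 : ℝ) < x := by exact_mod_cast h2
  have hyR : (0 : ℝ) < y := by exact_mod_cast h1
  have hxyR : (d : ℝ) ≤ x + y := by exact_mod_cast hxy
  have hd1 : (1 : ℝ) ≤ d := by exact_mod_cast hd
  have t1 : 1 ≤ ((x : ℝ) + y) / d := by rw [le_div_iff₀ hdR]; linarith
  have t2 : ((x : ℝ) + y) / d ≤ ((x + y : ℤ) : ℝ) := by
    push_cast
    exact div_le_self (by positivity) hd1
  have m1 := hull_seg S V b (x + y) hN (by simpa using memS b 1 hb one_pos h1.ne')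
    (memS b _ hb (by omega) h1.ne') _ t1 t2
  have m2 := hull_seg S V b' (x + y) hN (by simpa using memS b' 1 hb' one_pos hb'r)
    (memS b' _ hb' (by omega) hb'r) _ t1 t2
  have c := (convex_convexHull ℝ S) m1 m2 (a := (x : ℝ) / (x + y)) (b := (y : ℝ) / (x + y))
    (by positivity) (by positivity) (by field_simp)
  have pl := plucker b r b'
  rw [← hx, ← hy, ← hdd] at pl
  have p1 := congrArg (fun p : Pt => (p.1 : ℝ)) pl
  have p2 := congrArg (fun p : Pt => (p.2 : ℝ)) pl
  simp at p1 p2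
  convert c using 1
  ext
  · simp [toR]; field_simp; linear_combination ((x : ℝ) + y) * p1
  · simp [toR]; field_simp; linear_combination ((x : ℝ) + y) * p2

theorem cone_vdet {X V Y r : Pt} (hdet : 0 < vdet (X - V) (Y - V))
    (h : V + r ∈ conePts X V Y) : 0 ≤ vdet (X - V) r ∧ 0 ≤ vdet r (Y - V) := by
  obtain ⟨⟨q, s, t, hq, hs, ht, e⟩, hne⟩ := h
  rw [add_sub_cancel_left] at e
  have e1 : q * r.1 = s * (X - V).1 + t * (Y - V).1 := by
    simpa using congrArg Prod.fst e
  have e2 : q * r.2 = s * (X - V).2 + t * (Y - V).2 := by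
    simpa using congrArg Prod.snd e
  constructor
  · apply nonneg_of_mul_nonneg_right (a := q) _ hq
    have : q * vdet (X - V) r = t * vdet (X - V) (Y - V) := by
      unfold vdet; linear_combination (X - V).1 * e2 - (X - V).2 * e1
    rw [this]; positivity
  · apply nonneg_of_mul_nonneg_right (a := q) _ hq
    have : q * vdet r (Y - V) = s * vdet (X - V) (Y - V) := by
      unfold vdet; linear_combination (Y - V).2 * e1 - (Y - V).1 * e2
    rw [this]; positivity

theorem cone_pos {X V Y r : Pt} (hdet : 0 < vdet (X - V) (Y - V))
    (h : V + r ∈ conePts X V Y) : 0 < vdet (X - V) r + vdet r (Y - V) := by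
  obtain ⟨h1, h2⟩ := cone_vdet hdet h
  by_contra hc
  have z1 : vdet (X - V) r = 0 := by omega
  have z2 : vdet r (Y - V) = 0 := by omega
  have pl := plucker (X - V) r (Y - V)
  rw [z1, z2] at pl
  simp only [zero_smul, add_zero] at pl
  rcases smul_eq_zero.1 pl with h' | h'
  · omega
  · exact h.2 (by simp [h'])

theorem sail_ray_aux {X V Y r r' : Pt} (F F' : ℤ) (hF : 0 < F) (hlt : F < F')
    (e : F • r' = F' • r)
    (hP : V + r ∈ conePts X V Y) (hQ : SailVertex X V Y (V + r')) : False := by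
  apply hQ.2
  set S := toR '' (conePts X V Y \ {V + r'}) with hS
  have hr : r ≠ 0 := by rintro rfl; exact hP.2 (by simp)
  have memS : ∀ k : ℤ, 0 < k → F' ≠ F * k → toR (V + k • r) ∈ S := by
    intro k hk hv
    refine ⟨_, ⟨cone_smul hP k hk, ?_⟩, rfl⟩
    intro he
    have he : V + k • r = V + r' := he
    have he : k • r = r' := by simpa using he
    rw [← he, smul_smul] at e
    have : (F * k - F') • r = 0 := by rw [sub_smul, e, sub_self]
    rcases smul_eq_zero.1 this with h' | h'
    · omega
    · exact hr h'
  have hFR : (0 : ℝ) < F := by exact_mod_cast hF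
  have hF1 : (1 : ℝ) ≤ F := by exact_mod_cast hF
  have hltR : (F : ℝ) < F' := by exact_mod_cast hlt
  have m := hull_seg S V r (F' + 1) (by omega) (by simpa using memS 1 one_pos (by omega))
    (memS (F' + 1) (by omega) (by nlinarith)) ((F' : ℝ) / F)
    (by rw [le_div_iff₀ hFR]; linarith)
    (by push_cast
        have : (F' : ℝ) / F ≤ F' := div_le_self (by linarith) hF1
        linarith)
  have p1 := congrArg (fun p : Pt => (p.1 : ℝ)) e
  have p2 := congrArg (fun p : Pt => (p.2 : ℝ)) e
  simp at p1 p2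
  convert m using 1
  ext
  · simp [toR]; field_simp; linear_combination p1
  · simp [toR]; field_simp; linear_combination p2

theorem sail_ray {X V Y r r' : Pt} (hdet : 0 < vdet (X - V) (Y - V))
    (hP : SailVertex X V Y (V + r)) (hQ : SailVertex X V Y (V + r'))
    (h0 : vdet r r' = 0) : r = r' := by
  have f1 := cone_pos hdet hP.1
  have f2 := cone_pos hdet hQ.1
  set F := vdet (X - V) r + vdet r (Y - V) with hF
  set F' := vdet (X - V) r' + vdet r' (Y - V) with hF'
  have e : F • r' = F' • r := by
    ext
    · simp only [hF, hF']; simp only [vdet, Prod.smul_fst, smul_eq_mul] at h0 ⊢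
      linear_combination ((Y - V).1 - (X - V).1) * h0
    · simp only [hF, hF']; simp only [vdet, Prod.smul_snd, smul_eq_mul] at h0 ⊢
      linear_combination ((Y - V).2 - (X - V).2) * h0
  rcases lt_trichotomy F F' with h | h | h
  · exact (sail_ray_aux F F' f1 h e hP.1 hQ).elim
  · rw [h] at e
    exact (smul_right_injective Pt f2.ne' e).symm
  · exact (sail_ray_aux F' F f2 h e.symm hQ.1 hP).elim

theorem sail_sum {X V Y : Pt} {m : ℕ} {B : ℕ → Pt} (hdet : 0 < vdet (X - V) (Y - V))
    (h : IsSailBL X V Y m B) :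
    ∑ j ∈ Finset.range m, angMeasure (B j - V) (B (j + 1) - V) = angMeasure (X - V) (Y - V) := by
  obtain ⟨hS, -, hinj, ⟨s0, t0, hs0, ht0, e0⟩, ⟨s1, t1, hs1, ht1, e1⟩, hE⟩ := h
  have hS' : ∀ i ≤ m, SailVertex X V Y (V + (B i - V)) := by
    intro i hi; simpa using hS i hi
  have hb0 : ∀ i ≤ m, 0 ≤ vdet (B 0 - V) (B i - V) := by
    intro i hi
    have h1 := (cone_vdet hdet (hS' i hi).1).1
    apply nonneg_of_mul_nonneg_right (a := s0) _ hs0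
    have a1 : s0 * (B 0 - V).1 = t0 * (X - V).1 := by simpa using congrArg Prod.fst e0
    have a2 : s0 * (B 0 - V).2 = t0 * (X - V).2 := by simpa using congrArg Prod.snd e0
    have : s0 * vdet (B 0 - V) (B i - V) = t0 * vdet (X - V) (B i - V) := by
      unfold vdet; linear_combination (B i - V).2 * a1 - (B i - V).1 * a2
    rw [this]; positivity
  have hne : ∀ i ≤ m, ∀ j ≤ m, i ≠ j → vdet (B i - V) (B j - V) ≠ 0 := by
    intro i hi j hj hij h0
    have := sail_ray hdet (hS' i hi) (hS' j hj) h0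
    exact hij (hinj i hi j hj (by simpa using this))
  have hb0' : ∀ i ≤ m, 0 < i → 0 < vdet (B 0 - V) (B i - V) := by
    intro i hi h
    exact lt_of_le_of_ne (hb0 i hi) (hne 0 (by omega) i hi (by omega)).symm
  have hpos : ∀ i < m, 0 < vdet (B i - V) (B (i + 1) - V) := by
    intro i
    induction i with
    | zero => intro hi; exact hb0' 1 hi one_pos
    | succ i ih =>
      intro hi
      have ih := ih (by omega)
      by_contra hc
      have hlt : vdet (B (i + 1) - V) (B (i + 1 + 1) - V) < 0 :=
        lt_of_le_of_ne (not_lt.1 hc) (hne _ (by omega) _ (by omega) (by omega))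
      have hlt' : 0 < vdet (B (i + 1 + 1) - V) (B (i + 1) - V) := by
        simp [vdet] at hlt ⊢; linarith
      rcases lt_or_gt_of_ne (hne i (by omega) (i + 1 + 1) (by omega) (by omega)) with h | h
      · have h' : 0 < vdet (B (i + 1 + 1) - V) (B i - V) := by
          simp [vdet] at h ⊢; linarith
        have c := (hE (i + 1) hi).2 _ (hS i (by omega))
        apply sail_between (hS' i (by omega)) (hS' (i + 1 + 1) (by omega)).1
          (hS' (i + 1) (by omega)).1 h' ih hlt'
        have c1 : vdet (B (i + 1 + 1) - B (i + 1)) (V - B (i + 1)) =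
          - vdet (B (i + 1 + 1) - V) (B (i + 1) - V) := by simp [vdet]; ring
        rw [c1] at c
        have c2 : vdet (B (i + 1) - V - (B (i + 1 + 1) - V)) (B i - V - (B (i + 1 + 1) - V)) =
          - vdet (B (i + 1 + 1) - B (i + 1)) (B i - B (i + 1)) := by simp [vdet]; ring
        rw [c2]
        nlinarith
      · have c := (hE i (by omega)).2 _ (hS (i + 1 + 1) (by omega))
        apply sail_between (hS' (i + 1 + 1) (by omega)) (hS' i (by omega)).1
          (hS' (i + 1) (by omega)).1 h hlt' ih
        have c1 : vdet (B (i + 1) - B i) (V - B i) =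
          vdet (B i - V) (B (i + 1) - V) := by simp [vdet]; ring
        rw [c1] at c
        have c2 : vdet (B (i + 1) - V - (B i - V)) (B (i + 1 + 1) - V - (B i - V)) =
          vdet (B (i + 1) - B i) (B (i + 1 + 1) - B i) := by simp [vdet]
        rw [c2]
        nlinarith
  have hnz : ∀ i ≤ m, B i - V ≠ 0 := by
    intro i hi h0
    exact (hS i hi).1.2 (sub_eq_zero.1 h0)
  have tel : ∀ k ≤ m, ∑ j ∈ Finset.range k, angMeasure (B j - V) (B (j + 1) - V) =
      angMeasure (B 0 - V) (B k - V) := by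
    intro k
    induction k with
    | zero => intro _; simp [ang_self (hnz 0 (by omega))]
    | succ k ih =>
      intro hk
      rw [Finset.sum_range_succ, ih (by omega)]
      exact (ang_add (hb0' _ hk (by omega)) (hb0 _ (by omega)) (hpos k (by omega)).le
        (hnz k (by omega))).symm
  rw [tel m le_rfl, ← ang_smul hs0 hs1, e0, e1, ang_smul ht0 ht1]
def kstep (s : ℤ × ℤ) (x : ℤ) : ℤ × ℤ := (s.2, x * s.2 + s.1)

def krun (s : ℤ × ℤ) (l : List ℤ) : ℤ × ℤ := l.foldl kstep s

theorem krun_append (s : ℤ × ℤ) (l l' : List ℤ) : krun s (l ++ l') = krun (krun s l) l' := by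
  simp [krun, List.foldl_append]

theorem krun_reverse (r : List ℤ) : (krun (0, 1) r.reverse).2 = contRev r := by
  have key : ∀ (x : ℤ) (r : List ℤ), krun (0, 1) (x :: r).reverse =
      ((krun (0, 1) r.reverse).2, x * (krun (0, 1) r.reverse).2 + (krun (0, 1) r.reverse).1) := by
    intro x r
    rw [List.reverse_cons, krun_append]
    simp [krun, kstep]
  induction r using contRev.induct with
  | case1 => simp [krun, contRev]
  | case2 x => simp [krun, contRev, kstep]
  | case3 x y l ih1 ih2 =>
    rw [key, contRev]
    simp only
    rw [ih1, key]
    simp only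
    rw [ih2]

theorem cont_eq (l : List ℤ) : cont l = (krun (0, 1) l).2 := by
  rw [cont, ← krun_reverse, List.reverse_reverse]

theorem cont_tail_eq (l : List ℤ) (h : l ≠ []) : cont l.tail = (krun (1, 0) l).2 := by
  rw [cont_eq]
  cases l with
  | nil => exact absurd rfl h
  | cons x l => simp [krun, kstep]

theorem krun_lin (a b : ℤ) (l : List ℤ) :
    krun (a, b) l = (a * (krun (1, 0) l).1 + b * (krun (0, 1) l).1,
      a * (krun (1, 0) l).2 + b * (krun (0, 1) l).2) := by
  induction l using List.reverseRecOn with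
  | nil => simp [krun]
  | append_singleton l x ih =>
    rw [krun_append, krun_append, krun_append, ih]
    simp only [krun, kstep, List.foldl_cons, List.foldl_nil]
    ext
    · simp
    · simp; ring

theorem krun_det (l : List ℤ) :
    (krun (1, 0) l).1 * (krun (0, 1) l).2 - (krun (1, 0) l).2 * (krun (0, 1) l).1
      = (-1) ^ l.length := by
  induction l using List.reverseRecOn with
  | nil => simp [krun]
  | append_singleton l x ih =>
    rw [krun_append, krun_append]
    simp only [krun, kstep, List.foldl_cons, List.foldl_nil] at ih ⊢
    rw [List.length_append, pow_add, ← ih]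
    simp
    ring

theorem krun_pos (l : List ℤ) (h : l ≠ []) (hp : ∀ x ∈ l, 0 < x) :
    0 ≤ (krun (1, 0) l).1 ∧ 0 < (krun (1, 0) l).2 ∧ 0 < (krun (0, 1) l).1 ∧
    (krun (1, 0) l).2 ≤ (krun (0, 1) l).2 ∧ (krun (1, 0) l).1 ≤ (krun (0, 1) l).1 ∧
    (krun (0, 1) l).1 ≤ (krun (0, 1) l).2 := by
  induction l using List.reverseRecOn with
  | nil => exact absurd rfl h
  | append_singleton l x ih =>
    have hx : 0 < x := hp x (by simp)
    by_cases hl : l = []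
    · subst hl
      simp [krun, kstep]; omega
    · obtain ⟨h1, h2, h3, h4, h5, h6⟩ := ih hl (fun y hy => hp y (by simp [hy]))
      rw [krun_append, krun_append]
      set u := krun (1, 0) l
      set v := krun (0, 1) l
      simp only [krun, kstep, List.foldl_cons, List.foldl_nil]
      refine ⟨by omega, by positivity, by omega, ?_, h4, ?_⟩ <;> nlinarith

/-- run of the frame `(w,q)` of lattice vectors -/
def vrunW (w q : Pt) (l : List ℤ) : Pt := ((krun (w.1, q.1) l).1, (krun (w.2, q.2) l).1)
def vrunQ (w q : Pt) (l : List ℤ) : Pt := ((krun (w.1, q.1) l).2, (krun (w.2, q.2) l).2)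

theorem vrunW_eq (w q : Pt) (l : List ℤ) :
    vrunW w q l = (krun (1, 0) l).1 • w + (krun (0, 1) l).1 • q := by
  ext
  · simp [vrunW]; rw [krun_lin]; ring
  · simp [vrunW]; rw [krun_lin]; ring

theorem vrunQ_eq (w q : Pt) (l : List ℤ) :
    vrunQ w q l = (krun (1, 0) l).2 • w + (krun (0, 1) l).2 • q := by
  ext
  · simp [vrunQ]; rw [krun_lin]; ring
  · simp [vrunQ]; rw [krun_lin]; ring

theorem vrunW_append (w q : Pt) (l l' : List ℤ) :
    vrunW w q (l ++ l') = vrunW (vrunW w q l) (vrunQ w q l) l' := by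
  simp [vrunW, vrunQ, krun_append]

theorem vrunQ_append (w q : Pt) (l l' : List ℤ) :
    vrunQ w q (l ++ l') = vrunQ (vrunW w q l) (vrunQ w q l) l' := by
  simp [vrunW, vrunQ, krun_append]

theorem vrunW_cons (w q : Pt) (x : ℤ) (l : List ℤ) :
    vrunW w q (x :: l) = vrunW q (x • q + w) l := by
  simp [vrunW, krun, kstep]

theorem vrunQ_cons (w q : Pt) (x : ℤ) (l : List ℤ) :
    vrunQ w q (x :: l) = vrunQ q (x • q + w) l := by
  simp [vrunQ, krun, kstep]

theorem prim_mult {q w v : Pt} {ε s t : ℤ} (hw : ε * vdet w q = 1)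
    (hs : 0 < s) (ht : 0 < t) (e : s • q = t • v) :
    ∃ g : ℤ, 0 < g ∧ v = g • q ∧ (Int.gcd v.1 v.2 : ℤ) = g := by
  have e1 : s * q.1 = t * v.1 := by simpa using congrArg Prod.fst e
  have e2 : s * q.2 = t * v.2 := by simpa using congrArg Prod.snd e
  have hvq : vdet v q = 0 := by
    have : t * vdet v q = 0 := by
      unfold vdet; linear_combination (-q.2) * e1 + q.1 * e2
    rcases mul_eq_zero.1 this with h | h
    · omega
    · exact h
  have hv : v = (ε * vdet w v) • q := by
    ext
    · simp only [Prod.smul_fst, smul_eq_mul]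
      unfold vdet at *
      linear_combination (-v.1) * hw + ε * w.1 * hvq
    · simp only [Prod.smul_snd, smul_eq_mul]
      unfold vdet at *
      linear_combination (-v.2) * hw + ε * w.2 * hvq
  set g := ε * vdet w v with hg
  have hst : s = t * g := by
    have : t * g = s * (ε * vdet w q) := by
      simp only [hg]; unfold vdet; linear_combination ε * (w.2 * e1 - w.1 * e2)
    rw [this, hw, mul_one]
  have hgp : 0 < g := by
    by_contra hc
    nlinarith
  refine ⟨g, hgp, hv, ?_⟩
  have hcop : Int.gcd q.1 q.2 = 1 := by
    rw [← Int.isCoprime_iff_gcd_eq_one]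
    refine ⟨- ε * w.2, ε * w.1, ?_⟩
    unfold vdet at hw; linear_combination hw
  rw [hv]
  simp only [Prod.smul_fst, Prod.smul_snd, smul_eq_mul]
  rw [Int.gcd_mul_left, hcop, mul_one, Int.natCast_natAbs, abs_of_pos hgp]

theorem il_comm (P Q : Pt) : il P Q = il Q P := by
  unfold il
  rw [← Int.gcd_neg, ← Int.neg_gcd, neg_sub, neg_sub]

theorem near_unique {X V Y P p q r0 : Pt} {h g ε : ℤ} (hε : ε = 1 ∨ ε = -1)
    (hh : 0 < h) (hg : 0 < g) (hX : X - V = h • p) (hY : Y - V = g • q)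
    (hil1 : il V X = h) (hil2 : il V Y = g)
    (hr1 : ε * vdet r0 q = 1) (hr2 : 0 ≤ ε * vdet p r0) (hr3 : ε * vdet p r0 < ε * vdet p q)
    (hP : IsNearPt X V Y P) : P = V + r0 := by
  obtain ⟨⟨Q, S, T, hQ, hS, hT, e⟩, hd, hmin⟩ := hP
  have absε : ∀ x : ℤ, |ε * x| = |x| := by
    intro x; rcases hε with rfl | rfl <;> simp
  -- integer distances
  have id1 : ∀ R : Pt, idist R V Y = |vdet (R - V) q| := by
    intro R
    unfold idist
    rw [hil2, hY]
    have : vdet (g • q) (R - V) = g * (- vdet (R - V) q) := by simp [vdet]; ring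
    rw [this, abs_mul, abs_of_pos hg, abs_neg, Int.mul_ediv_cancel_left _ hg.ne']
  have id2 : ∀ R : Pt, idist R X V = |vdet p (R - V)| := by
    intro R
    unfold idist
    rw [il_comm, hil1]
    have : vdet (V - X) (R - X) = h * (- vdet p (R - V)) := by
      have e1 : X.1 = V.1 + h * p.1 := by
        have := congrArg Prod.fst hX; simp at this; linarith
      have e2 : X.2 = V.2 + h * p.2 := by
        have := congrArg Prod.snd hX; simp at this; linarith
      simp [vdet, e1, e2]; ring
    rw [this, abs_mul, abs_of_pos hh, abs_neg, Int.mul_ediv_cancel_left _ hh.ne']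
  set r := P - V with hr
  rw [hX, hY] at e
  have e1 : Q * r.1 = S * (h * p.1) + T * (g * q.1) := by simpa using congrArg Prod.fst e
  have e2 : Q * r.2 = S * (h * p.2) + T * (g * q.2) := by simpa using congrArg Prod.snd e
  have hdd : 0 < ε * vdet p q := by omega
  have n1 : 0 ≤ ε * vdet r q := by
    apply nonneg_of_mul_nonneg_right (a := Q) _ hQ
    have : Q * (ε * vdet r q) = S * h * (ε * vdet p q) := by
      unfold vdet; linear_combination ε * (q.2 * e1 - q.1 * e2)
    rw [this]; positivity
  have n2 : 0 ≤ ε * vdet p r := by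
    apply nonneg_of_mul_nonneg_right (a := Q) _ hQ
    have : Q * (ε * vdet p r) = T * g * (ε * vdet p q) := by
      unfold vdet; linear_combination ε * (p.1 * e2 - p.2 * e1)
    rw [this]; positivity
  rw [id1, ← hr, ← absε, abs_of_nonneg n1] at hd
  have hin : InAngle X V Y (V + r0) := by
    refine ⟨(ε * vdet p q) * h * g, g * (ε * vdet r0 q), h * (ε * vdet p r0), by positivity,
      by rw [hr1]; omega, by positivity, ?_⟩
    rw [hX, hY, add_sub_cancel_left]
    ext
    · simp [vdet]; ring
    · simp [vdet]; ring
  have hm := hmin (V + r0) hin (by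
    rw [id1, add_sub_cancel_left, ← absε, hr1]; rfl)
  rw [id2, id2, ← hr, add_sub_cancel_left, ← absε, abs_of_nonneg n2, ← absε,
    abs_of_nonneg hr2] at hm
  -- r = r0 + k q
  set k := ε * vdet r0 (r - r0) with hk
  have hε2 : ε * ε = 1 := by rcases hε with rfl | rfl <;> rfl
  have hz : ε * vdet (r - r0) q = 0 := by
    have : ε * vdet (r - r0) q = ε * vdet r q - ε * vdet r0 q := by simp [vdet]; ring
    rw [this, hd, hr1]; rfl
  have hrk : r = r0 + k • q := by
    have h1 : (r - r0) = k • q := by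
      ext
      · simp only [Prod.smul_fst, smul_eq_mul, hk]
        unfold vdet at *
        linear_combination (-(r - r0).1) * hr1 + r0.1 * hz
      · simp only [Prod.smul_snd, smul_eq_mul, hk]
        unfold vdet at *
        linear_combination (-(r - r0).2) * hr1 + r0.2 * hz
    rw [← h1]; abel
  have hv : ε * vdet p r = ε * vdet p r0 + k * (ε * vdet p q) := by
    rw [hrk]; simp [vdet]; ring
  have hk0 : k = 0 := by
    rcases lt_trichotomy k 0 with h | h | h
    · nlinarith
    · exact h
    · nlinarith
  rw [hk0, zero_smul, add_zero] at hrk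
  rw [← hrk, hr]; abel
theorem vdet_lc1 (p s : Pt) (a b : ℤ) : vdet p (a • p + b • s) = b * vdet p s := by
  simp [vdet]; ring

theorem vdet_lc2 (p s : Pt) (a b : ℤ) : vdet s (a • p + b • s) = -(a * vdet p s) := by
  simp [vdet]; ring

theorem vdet_vrun (p s : Pt) (l : List ℤ) :
    vdet (vrunW p s l) (vrunQ p s l) = (-1) ^ l.length * vdet p s := by
  rw [vrunW_eq, vrunQ_eq, ← krun_det]
  simp [vdet]; ring

def FrameAt (X V Y : Pt) (l : List ℤ) (p s : Pt) : Prop :=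
  ValidLLS l ∧ vdet p s = 1 ∧ (0 < il V X ∧ X - V = il V X • p) ∧
    (0 < il V Y ∧ Y - V = il V Y • vrunQ p s l)

theorem valid_ne {l : List ℤ} (h : ValidLLS l) : l ≠ [] := by
  rintro rfl
  simp [ValidLLS] at h

theorem valid_pow {l : List ℤ} (h : ValidLLS l) : (-1 : ℤ) ^ l.length = -1 :=
  Odd.neg_one_pow (Nat.odd_iff.2 h.1)

theorem frame_exists {X V Y : Pt} {l : List ℤ} (hdet : 0 < vdet (X - V) (Y - V))
    (h : IsLLSOfAngle X V Y l) : ∃ p s, FrameAt X V Y l p s := by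
  obtain ⟨hl, T, hT0, ⟨s1, t1, hs1, ht1, e1⟩, ⟨s2, t2, hs2, ht2, e2⟩⟩ := h
  have hu : T.u = V.1 := by simpa [IntAff.apply] using congrArg Prod.fst hT0
  have hv : T.v = V.2 := by simpa [IntAff.apply] using congrArg Prod.snd hT0
  set p : Pt := (T.a, T.c) with hp
  set s : Pt := (T.b, T.d) with hs
  have ep : T.apply ((1, 0) : Pt) - V = p := by
    ext <;> simp [IntAff.apply, hu, hv, hp]
  have eq : T.apply (stdPt l) - V = vrunQ p s l := by
    rw [vrunQ_eq, stdPt, cont_tail_eq l (valid_ne hl), cont_eq]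
    ext
    · simp [IntAff.apply, hu, hp, hs]; ring
    · simp [IntAff.apply, hv, hp, hs]; ring
  rw [ep] at e1
  rw [eq] at e2
  obtain ⟨-, -, h3, -, -, h6⟩ := krun_pos l (valid_ne hl) hl.2
  have hvd : vdet p s = T.a * T.d - T.b * T.c := by simp [vdet, hp, hs]; ring
  have hpq : vdet p (vrunQ p s l) = (krun (0, 1) l).2 * vdet p s := by
    rw [vrunQ_eq]; simp [vdet]; ring
  have hd1 : vdet p s = 1 := by
    rcases T.unimod with h | h
    · rw [hvd, h]
    · exfalso
      rw [hvd, h] at hpq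
      have a1 : s1 * p.1 = t1 * (X - V).1 := by simpa using congrArg Prod.fst e1
      have a2 : s1 * p.2 = t1 * (X - V).2 := by simpa using congrArg Prod.snd e1
      have b1 : s2 * (vrunQ p s l).1 = t2 * (Y - V).1 := by simpa using congrArg Prod.fst e2
      have b2 : s2 * (vrunQ p s l).2 = t2 * (Y - V).2 := by simpa using congrArg Prod.snd e2
      have : (s1 * s2) * vdet p (vrunQ p s l) = (t1 * t2) * vdet (X - V) (Y - V) := by
        unfold vdet
        calc _ = (s1 * p.1) * (s2 * (vrunQ p s l).2) - (s1 * p.2) * (s2 * (vrunQ p s l).1) := by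
              ring
          _ = _ := by rw [a1, a2, b1, b2]; ring
      have h1 : 0 < (t1 * t2) * vdet (X - V) (Y - V) := by positivity
      rw [← this, hpq] at h1
      have h2 : 0 < s1 * s2 * (krun (0, 1) l).2 := mul_pos (mul_pos hs1 hs2) (by omega)
      linarith
  obtain ⟨g1, hg1, k1, k2⟩ := prim_mult (q := p) (w := s) (ε := -1)
    (by have : vdet s p = - vdet p s := by simp [vdet]; ring
        rw [this, hd1]; rfl) hs1 ht1 e1
  obtain ⟨g2, hg2, j1, j2⟩ := prim_mult (q := vrunQ p s l) (w := vrunW p s l) (ε := -1)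
    (by rw [vdet_vrun, valid_pow hl, hd1]; rfl) hs2 ht2 e2
  have i1 : il V X = g1 := k2
  have i2 : il V Y = g2 := j2
  refine ⟨p, s, hl, hd1, ?_, ?_⟩
  · rw [i1]; exact ⟨hg1, k1⟩
  · rw [i2]; exact ⟨hg2, j1⟩

theorem sgn_mul_gcd {q w : Pt} (hw : vdet w q = -1) (g c : ℤ) (hg : 0 < g) :
    sgnDir (g • q) (c • q) * (Int.gcd (c * q.1) (c * q.2) : ℤ) = c := by
  have hq : q ≠ 0 := vdet_ne_right (u := w) (by omega)
  have hcop : Int.gcd q.1 q.2 = 1 := by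
    rw [← Int.isCoprime_iff_gcd_eq_one]
    refine ⟨w.2, -w.1, ?_⟩
    unfold vdet at hw; linear_combination -hw
  rw [Int.gcd_mul_left, hcop, mul_one, Int.natCast_natAbs]
  unfold sgnDir
  rcases lt_trichotomy c 0 with h | h | h
  · rw [if_neg, if_neg, abs_of_neg h]
    · ring
    · rintro ⟨s, t, hs, ht, e⟩
      rw [smul_smul, smul_smul] at e
      have e := smul_left_injective ℤ hq e
      have : s * c < 0 := mul_neg_of_pos_of_neg hs h
      have : 0 < t * g := mul_pos ht hg
      omega
    · intro h'
      rcases smul_eq_zero.1 h' with h' | h'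
      · omega
      · exact hq h'
  · rw [h]; simp
  · rw [if_neg, if_pos, abs_of_pos h]
    · ring
    · exact ⟨g, c, hg, h, smul_comm _ _ _⟩
    · intro h'
      rcases smul_eq_zero.1 h' with h' | h'
      · omega
      · exact hq h'

theorem chord_step {A B C D p s p' s' : Pt} {l l' : List ℤ} {k : ℤ}
    (h1 : FrameAt A B C l p s) (h2 : FrameAt B C D l' p' s') (hk : IsChordCurv A B C D k) :
    p' = - vrunQ p s l ∧ s' = - (k • vrunQ p s l + vrunW p s l) := by
  obtain ⟨hl, hd, ⟨a1, a2⟩, ⟨b1, b2⟩⟩ := h1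
  obtain ⟨hl', hd', ⟨a1', a2'⟩, ⟨b1', b2'⟩⟩ := h2
  obtain ⟨B', C', hB, hC, hk⟩ := hk
  obtain ⟨-, -, u3, -, -, u6⟩ := krun_pos l (valid_ne hl) hl.2
  obtain ⟨-, v2, v3, v4, -, v6⟩ := krun_pos l' (valid_ne hl') hl'.2
  have hwq : vdet (vrunW p s l) (vrunQ p s l) = -1 := by
    rw [vdet_vrun, valid_pow hl, hd]; rfl
  have hpw : vdet p (vrunW p s l) = (krun (0, 1) l).1 := by
    rw [vrunW_eq, vdet_lc1, hd, mul_one]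
  have hpq : vdet p (vrunQ p s l) = (krun (0, 1) l).2 := by
    rw [vrunQ_eq, vdet_lc1, hd, mul_one]
  have hpq' : vdet p' (vrunQ p' s' l') = (krun (0, 1) l').2 := by
    rw [vrunQ_eq, vdet_lc1, hd', mul_one]
  have hsq' : vdet s' (vrunQ p' s' l') = - (krun (1, 0) l').2 := by
    rw [vrunQ_eq, vdet_lc2, hd', mul_one]
  set q := vrunQ p s l
  set w := vrunW p s l
  set q' := vrunQ p' s' l'
  have hp' : p' = -q := by
    rw [il_comm] at a2' a1'
    have : il B C • p' = il B C • (-q) := by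
      rw [← a2', smul_neg, ← b2]; abel
    exact smul_right_injective Pt b1.ne' this
  have eB : B' = B + (q - w) := by
    refine near_unique (ε := 1) (Or.inl rfl) a1 b1 a2 b2 rfl rfl ?_ ?_ ?_ hB
    · have : vdet (q - w) q = - vdet w q := by simp [vdet]; ring
      rw [this, hwq]; rfl
    · have : vdet p (q - w) = vdet p q - vdet p w := by simp [vdet]; ring
      rw [this, hpq, hpw]; omega
    · have : vdet p (q - w) = vdet p q - vdet p w := by simp [vdet]; ring
      rw [this, hpq, hpw]; omega
  have eC : C' = C + (s' + p') := by
    have c1 : vdet q' (s' + p') = - vdet s' q' - vdet p' q' := by simp [vdet]; ring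
    have c2 : vdet q' p' = - vdet p' q' := by simp [vdet]; ring
    refine near_unique (ε := -1) (Or.inr rfl) b1' a1' b2' a2' rfl rfl ?_ ?_ ?_ hC
    · have : vdet (s' + p') p' = - vdet p' s' := by simp [vdet]; ring
      rw [this, hd']; rfl
    · rw [c1, hsq', hpq']; omega
    · rw [c1, c2, hsq', hpq']; omega
  have hqs : vdet (s' + w) q = 0 := by
    have : vdet (s' + w) q = vdet p' s' + vdet w q := by rw [hp']; simp [vdet]; ring
    rw [this, hd', hwq]; rfl
  obtain ⟨c, hc⟩ : ∃ c : ℤ, s' + w = c • q := by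
    refine ⟨- vdet w (s' + w), ?_⟩
    ext
    · simp only [Prod.smul_fst, smul_eq_mul]
      unfold vdet at *
      linear_combination (s' + w).1 * hwq - w.1 * hqs
    · simp only [Prod.smul_snd, smul_eq_mul]
      unfold vdet at *
      linear_combination (s' + w).2 * hwq - w.2 * hqs
  have hCB : C' - B' = (il B C + c - 2) • q := by
    have : C' - B' = (C - B) + (s' + w) + (p' - q) := by rw [eB, eC]; abel
    rw [this, b2, hc, hp', sub_smul, add_smul, two_smul]; abel
  have hilBC : il B' C' = (Int.gcd ((il B C + c - 2) * q.1) ((il B C + c - 2) * q.2) : ℤ) := by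
    have e1 := congrArg Prod.fst hCB
    have e2 := congrArg Prod.snd hCB
    simp only [Prod.fst_sub, Prod.snd_sub, Prod.smul_fst, Prod.smul_snd, smul_eq_mul] at e1 e2
    unfold il at *
    rw [e1, e2]
  have key := sgn_mul_gcd hwq (il B C) (il B C + c - 2) b1
  rw [hCB, hilBC, b2, key] at hk
  refine ⟨hp', ?_⟩
  have hkc : k = -c := by omega
  rw [hkc, neg_smul, ← hc]; abel

theorem frame_chain {L : ℕ → List ℤ} {κ : ℕ → ℤ} {p s : ℕ → Pt} {n : ℕ}
    (hp : ∀ i, i + 1 < n → p (i + 1) = - vrunQ (p i) (s i) (L i) ∧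
      s (i + 1) = - (κ i • vrunQ (p i) (s i) (L i) + vrunW (p i) (s i) (L i))) :
    ∀ j < n, vrunW (p 0) (s 0) (llsCat L κ 0 j) = sgnAlt j • vrunW (p j) (s j) (L j) ∧
      vrunQ (p 0) (s 0) (llsCat L κ 0 j) = sgnAlt j • vrunQ (p j) (s j) (L j) := by
  intro j
  induction j with
  | zero => intro _; simp [llsCat, sgnAlt]
  | succ j ih =>
    intro hj
    obtain ⟨h1, h2⟩ := ih (by omega)
    obtain ⟨h3, h4⟩ := hp j hj
    have hQ : ∀ (t : ℤ) (u v : Pt) (l : List ℤ), vrunQ (t • u) (t • v) l = t • vrunQ u v l := by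
      intro t u v l
      rw [vrunQ_eq, vrunQ_eq, smul_add, smul_comm t, smul_comm t]
    have hW : ∀ (t : ℤ) (u v : Pt) (l : List ℤ), vrunW (t • u) (t • v) l = t • vrunW u v l := by
      intro t u v l
      rw [vrunW_eq, vrunW_eq, smul_add, smul_comm t, smul_comm t]
    rw [llsCat, zero_add, vrunW_append, vrunQ_append, vrunW_cons, vrunQ_cons, h1, h2]
    have e1 : sgnAlt j • vrunQ (p j) (s j) (L j) = sgnAlt (j + 1) • p (j + 1) := by
      rw [h3, sgnAlt_succ, neg_smul, smul_neg, neg_neg]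
    have e2 : κ j • sgnAlt j • vrunQ (p j) (s j) (L j) + sgnAlt j • vrunW (p j) (s j) (L j) =
        sgnAlt (j + 1) • s (j + 1) := by
      rw [h4, sgnAlt_succ, neg_smul, smul_neg, neg_neg, smul_add, smul_comm]
    rw [e2, e1, hQ, hW]
    exact ⟨rfl, rfl⟩

theorem cont_vdet {p s : Pt} (h : vdet p s = 1) (l : List ℤ) :
    cont l = vdet p (vrunQ p s l) := by
  rw [cont_eq, vrunQ_eq, vdet_lc1, h, mul_one]
theorem main_aux (N : ℕ) (hn : 3 ≤ N + 2)
    (A : ZMod (N + 2) → Pt) (hA : ConvexPolygon (N + 2) A)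
    (L : ℕ → List ℤ) (κ : ℕ → ℤ) (hacs : HasACS (N + 2) A L κ)
    (M : ℕ) (D : ℕ → Pt) (hD : IsSailDiagram (N + 2) A M D) :
    (signChanges ((List.range (N + 2)).map fun j => cont (llsCat L κ 0 j)) : ℝ) =
      2 * winding M D - 1 := by
  have inj : ∀ x y : ℕ, x < N + 2 → y < N + 2 → (x : ZMod (N + 2)) = y → x = y := by
    intro x y hx hy h
    rw [ZMod.natCast_eq_natCast_iff', Nat.mod_eq_of_lt hx, Nat.mod_eq_of_lt hy] at h
    exact h
  have hone : (1 : ZMod (N + 2)) ≠ 0 := by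
    intro h
    have := inj 1 0 (by omega) (by omega) (by simpa using h)
    omega
  have htwo : (2 : ZMod (N + 2)) ≠ 0 := by
    intro h
    have := inj 2 0 (by omega) (by omega) (by simpa using h)
    omega
  have hN2 : ((N : ZMod (N + 2)) + 2) = 0 := by
    have := ZMod.natCast_self (N + 2)
    push_cast at this
    exact this
  have hm1 : (0 : ZMod (N + 2)) - 1 = ((N + 1 : ℕ) : ZMod (N + 2)) := by
    push_cast
    linear_combination -hN2
  have hN1 : ((N + 1 : ℕ) : ZMod (N + 2)) + 1 = 0 := by
    push_cast
    linear_combination hN2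
  have hloc : ∀ z : ZMod (N + 2), 0 < vdet (A (z - 1) - A z) (A (z + 1) - A z) := by
    intro z
    have := hA z (z - 1) (by intro h; apply hone; linear_combination -h)
      (by intro h; apply htwo; linear_combination -h)
    simp [vdet] at this ⊢; linarith
  set a : ℕ → Pt := fun i => A (i : ZMod (N + 2)) with ha
  have asucc : ∀ i : ℕ, A ((i : ZMod (N + 2)) + 1) = a (i + 1) := by
    intro i; simp [ha]
  have h0 : ∀ i j, i + 1 < N + 2 → j < N + 2 → j ≠ i → j ≠ i + 1 →
      vdet (a (i + 1) - a i) (a j - a i) < 0 := by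
    intro i j hi hj h1 h2
    have := hA i j (fun h => h1 (inj _ _ hj (by omega) h))
      (fun h => h2 (inj _ _ hj hi (by push_cast; exact h)))
    rw [asucc] at this
    exact this
  -- the winding number
  set f : ℕ → ℝ := fun i => angMeasure (A ((i : ZMod (N + 2)) - 1) - A (i : ZMod (N + 2)))
    (A ((i : ZMod (N + 2)) + 1) - A (i : ZMod (N + 2))) with hf
  have hsum : ∑ i ∈ Finset.range (N + 2), f i = N * Real.pi := by
    have h := angle_sum (N + 2) hn a h0 N le_rfl
    rw [Finset.sum_range_succ', Finset.sum_range_succ, ← h]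
    have e0 : f 0 = angMeasure (a (N + 1) - a 0) (a 1 - a 0) := by
      simp only [hf, ha, Nat.cast_zero, Nat.cast_one, zero_add]
      rw [hm1]
    have e1 : f (N + 1) = angMeasure (a N - a (N + 1)) (a 0 - a (N + 1)) := by
      simp only [hf, ha, hN1]
      simp
    have e2 : ∀ i, f (i + 1) = angMeasure (a i - a (i + 1)) (a (i + 2) - a (i + 1)) := by
      intro i
      simp only [hf, asucc]
      simp [ha]
      rw [show ((i : ZMod (N + 2)) + 1 + 1) = i + 2 by ring]
    rw [e0, e1, Finset.sum_congr rfl (fun i _ => e2 i)]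
    ring
  have hw : winding M D = N / 2 := by
    obtain ⟨m, c, B, ⟨hc0, hc, hB⟩, rfl⟩ := hD
    have : ∀ k ≤ N + 2, ∑ i ∈ Finset.range (c k), angMeasure (D i) (D (i + 1)) =
        ∑ i ∈ Finset.range k, f i := by
      intro k
      induction k with
      | zero => intro _; simp [hc0]
      | succ k ih =>
        intro hk
        obtain ⟨hS, hDk⟩ := hB k (by omega)
        rw [hc, Finset.sum_range_add, ih (by omega), Finset.sum_range_succ]
        congr 1
        simp only [hf]
        rw [← sail_sum (hloc k) hS]
        apply Finset.sum_congr rfl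
        intro j hj
        rw [Finset.mem_range] at hj
        rw [hDk j hj.le, add_assoc, hDk (j + 1) hj, ang_sgn]
    unfold winding
    rw [this _ le_rfl, hsum]
    have := Real.pi_ne_zero
    field_simp
  -- sign changes
  have hsc : signChanges ((List.range (N + 2)).map fun j => cont (llsCat L κ 0 j))
      = N + 2 - 3 := by
    apply signChanges_main (N + 2) hn (fun j => vdet (a (N + 1) - a 0)
      (A ((j : ZMod (N + 2)) + 1) - a j))
    · have hfr : ∀ i : ℕ, ∃ p s, i < N + 2 → FrameAt (A ((i : ZMod (N + 2)) - 1))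
          (A (i : ZMod (N + 2))) (A ((i : ZMod (N + 2)) + 1)) (L i) p s := by
        intro i
        by_cases hi : i < N + 2
        · obtain ⟨p, s, h⟩ := frame_exists (hloc i) (hacs i hi).1
          exact ⟨p, s, fun _ => h⟩
        · exact ⟨0, 0, fun h => absurd h hi⟩
      choose p s hps using hfr
      have hch := frame_chain (L := L) (κ := κ) (p := p) (s := s) (n := N + 2) (by
        intro i hi
        have h2 := hps (i + 1) hi
        have c1 : ((i + 1 : ℕ) : ZMod (N + 2)) - 1 = i := by push_cast; ring
        have c2 : ((i + 1 : ℕ) : ZMod (N + 2)) + 1 = i + 2 := by push_cast; ring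
        rw [c1, c2] at h2
        push_cast at h2
        exact chord_step (hps i (by omega)) h2 (hacs i (by omega)).2)
      intro j hj
      obtain ⟨-, hd, ⟨hp1, hp2⟩, -⟩ := hps 0 (by omega)
      obtain ⟨-, -, -, ⟨hq1, hq2⟩⟩ := hps j hj
      have hK := cont_vdet hd (llsCat L κ 0 j)
      rw [(hch j hj).2] at hK
      refine ⟨_, mul_pos hp1 hq1, ?_⟩
      have e1 : a (N + 1) - a 0 = A (((0 : ℕ) : ZMod (N + 2)) - 1) - A ((0 : ℕ) : ZMod (N + 2)) := by
        simp only [ha]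
        rw [Nat.cast_zero, hm1]
      rw [hK, e1, hp2]
      have e2 : A ((j : ZMod (N + 2)) + 1) - a j = _ := hq2
      rw [e2]
      generalize il (A ((0 : ℕ) : ZMod (N + 2))) (A (((0 : ℕ) : ZMod (N + 2)) - 1)) = h
      generalize il (A (j : ZMod (N + 2))) (A ((j : ZMod (N + 2)) + 1)) = g
      simp [vdet]; ring
    · have := hloc 0
      rw [hm1] at this
      simpa [ha] using this
    · have := hloc ((N + 1 : ℕ) : ZMod (N + 2))
      rw [hN1] at this
      simp only [Nat.add_sub_cancel, asucc]
      simp only [Nat.cast_add, Nat.cast_one, add_sub_cancel_right] at this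
      simp [ha]
      simp [vdet] at this ⊢
      linarith
    · have : N + 2 - 1 = N + 1 := by omega
      simp only [this, hN1]
      simp [ha, vdet]; ring
    · intro j hj hxj
      simp only [asucc] at hxj ⊢
      have d0 := hA ((N + 1 : ℕ) : ZMod (N + 2)) ((j + 1 : ℕ) : ZMod (N + 2))
        (by intro h; have := inj _ _ (by omega) (by omega) h; omega)
        (by rw [hN1]; intro h; have := inj (j + 1) 0 (by omega) (by omega) (by simpa using h); omega)
      rw [hN1] at d0
      have d0' : vdet (a 0 - a (N + 1)) (a (j + 1) - a (N + 1)) < 0 := by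
        simpa [ha] using d0
      by_cases hjN : j + 1 = N
      · subst hjN
        simp [vdet] at d0' ⊢; linarith
      · have c1 := h0 j (j + 1 + 1 + (N - j - 1)) (by omega) (by omega) (by omega) (by omega)
        rw [show j + 1 + 1 + (N - j - 1) = N + 1 by omega] at c1
        have c2 := h0 (j + 1) (N + 1) (by omega) (by omega) (by omega) (by omega)
        have c3 := h0 j (j + 1 + 1) (by omega) (by omega) (by omega) (by omega)
        by_contra hc
        rw [not_lt] at hc
        have f1 : vdet (a (j + 1) - a j) (a (N + 1) - a (j + 1)) < 0 := by
          simp [vdet] at c1 ⊢; linarith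
        have f3 : vdet (a (j + 1) - a j) (a (j + 1 + 1) - a (j + 1)) < 0 := by
          simp [vdet] at c3 ⊢; linarith
        have f4 : vdet (a (N + 1) - a 0) (a (N + 1) - a (j + 1)) < 0 := by
          simp [vdet] at d0' ⊢; linarith
        have id4 : ∀ U e e' d : Pt, vdet U e * vdet e' d - vdet U e' * vdet e d
            + vdet U d * vdet e e' = 0 := by
          intro U e e' d; simp only [vdet]; ring
        have := id4 (a (N + 1) - a 0) (a (j + 1) - a j) (a (j + 1 + 1) - a (j + 1))
          (a (N + 1) - a (j + 1))
        have g1 := mul_nonneg_of_nonpos_of_nonpos hxj c2.le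
        have g2 := mul_nonpos_of_nonneg_of_nonpos hc f1.le
        have g3 := mul_pos_of_neg_of_neg f4 f3
        linarith
  rw [hsc, hw]
  obtain ⟨K, rfl⟩ : ∃ K, N = K + 1 := ⟨N - 1, by omega⟩
  rw [show K + 1 + 2 - 3 = K by omega]
  push_cast
  ring

/-- **Proposition.** Let `A₀…A_M` be the sail diagram of a convex `n`-gon with
angle-curvature sequence `S = (α₁,κ₁,…,αₙ,κₙ)`. Then the number of sign changes
of the sequence `(K(lls(S₁ʲ)))_{j=1}^{n}` equals twice the winding number of the
sail diagram about the origin, minus 1. -/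
theorem sign_changes_eq_twice_winding_minus_one (n : ℕ) (hn : 3 ≤ n)
    (A : ZMod n → Pt) (hA : ConvexPolygon n A)
    (L : ℕ → List ℤ) (κ : ℕ → ℤ) (hacs : HasACS n A L κ)
    (M : ℕ) (D : ℕ → Pt) (hD : IsSailDiagram n A M D) :
    (signChanges ((List.range n).map fun j => cont (llsCat L κ 0 j)) : ℝ) =
      2 * winding M D - 1 := by
  obtain ⟨N, rfl⟩ : ∃ N, n = N + 2 := ⟨n - 2, by omega⟩
  exact main_aux N hn A hA L κ hacs M D hD
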